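/- There exists a four-player LTL game G whose strong core SC(G) is empty: every strategy profile admits a strong beneficial deviation by some coalition. -/

import Mathlib

/-- A concurrent game structure over a set of agents `Ag`, states `St`, and,
for each agent `i`, a set of actions `Ac i`.  It consists of an initial state
and a transition function. -/
structure CGS (Ag St : Type) (Ac : Ag → Type) where
  init : St
  tr : St → (∀ i, Ac i) → St

/-- A strategy for a player with actions `A`: it maps finite (nonempty)
histories of states, given as lists, to an action. -/
abbrev Strategy (St A : Type) := List St → A

/-- A strategy profile: one strategy for each player. -/
abbrev Profile {Ag : Type} (St : Type) (Ac : Ag → Type) := ∀ i, Strategy St (Ac i)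

namespace CGS

variable {Ag St : Type} {Ac : Ag → Type}

/-- The history `ρ(σ)[0 … t]` (as a list) together with the current state
`ρ(σ)[t]` of the run induced by a strategy profile `σ`. -/
def histRun (M : CGS Ag St Ac) (σ : Profile St Ac) : ℕ → List St × St
  | 0 => ([M.init], M.init)
  | t + 1 =>
      let p := histRun M σ t
      let s := M.tr p.2 (fun i => σ i p.1)
      (p.1 ++ [s], s)

/-- The unique run `ρ(σ)` induced by a strategy profile `σ`. -/
def run (M : CGS Ag St Ac) (σ : Profile St Ac) (t : ℕ) : St :=
  (histRun M σ t).2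

/-- A run of `M`: an infinite state sequence starting at the initial state in
which every step is obtained by some action profile. -/
def IsRun (M : CGS Ag St Ac) (ρ : ℕ → St) : Prop :=
  ρ 0 = M.init ∧ ∀ t, ∃ a : ∀ i, Ac i, ρ (t + 1) = M.tr (ρ t) a

end CGS

open Classical in
/-- Combine a joint strategy `σC` for a coalition `C` with strategies `σN`
for the players outside `C`, obtaining a full strategy profile. -/
noncomputable def combine {Ag St : Type} {Ac : Ag → Type} (C : Set Ag)
    (σC : ∀ i ∈ C, Strategy St (Ac i)) (σN : ∀ i ∉ C, Strategy St (Ac i)) :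
    Profile St Ac :=
  fun i => if h : i ∈ C then σC i h else σN i h

/-- Syntax of Linear Temporal Logic over atomic propositions `AP`:
atoms, negation, disjunction, next, and until. -/
inductive LTLFormula (AP : Type) where
  | atom : AP → LTLFormula AP
  | neg  : LTLFormula AP → LTLFormula AP
  | disj : LTLFormula AP → LTLFormula AP → LTLFormula AP
  | next : LTLFormula AP → LTLFormula AP
  | untl : LTLFormula AP → LTLFormula AP → LTLFormula AP

/-- Standard LTL semantics over infinite runs `ρ : ℕ → St`, via a labelling
function `lab : St → Set AP`. -/
def LTLFormula.Sat {AP St : Type} (lab : St → Set AP) :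
    LTLFormula AP → (ℕ → St) → Prop
  | .atom p, ρ => p ∈ lab (ρ 0)
  | .neg φ, ρ => ¬ LTLFormula.Sat lab φ ρ
  | .disj φ ψ, ρ => LTLFormula.Sat lab φ ρ ∨ LTLFormula.Sat lab ψ ρ
  | .next φ, ρ => LTLFormula.Sat lab φ (fun t => ρ (t + 1))
  | .untl φ ψ, ρ =>
      ∃ j : ℕ, LTLFormula.Sat lab ψ (fun t => ρ (t + j)) ∧
        ∀ k < j, LTLFormula.Sat lab φ (fun t => ρ (t + k))

/-- An LTL game: a concurrent game structure together with a labelling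
function and an LTL goal for each player. -/
structure LTLGame (Ag St : Type) (Ac : Ag → Type) (AP : Type) where
  M : CGS Ag St Ac
  lab : St → Set AP
  goal : Ag → LTLFormula AP

namespace LTLGame

variable {Ag St AP : Type} {Ac : Ag → Type}

/-- The winners of a run: players whose goal is satisfied by the run. -/
def winners (G : LTLGame Ag St Ac AP) (ρ : ℕ → St) : Set Ag :=
  {i | (G.goal i).Sat G.lab ρ}

/-- `σC` is a beneficial deviation for the (nonempty) coalition `C` from the
strategy profile `σ`: every member of `C` loses under `σ`, and all members of
`C` win under `(σC, σN)` no matter which joint strategy `σN` the remaining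
players use. -/
def BeneficialDeviation (G : LTLGame Ag St Ac AP) (C : Set Ag)
    (σ : Profile St Ac) (σC : ∀ i ∈ C, Strategy St (Ac i)) : Prop :=
  C.Nonempty ∧
  C ⊆ (G.winners (G.M.run σ))ᶜ ∧
  ∀ σN : ∀ i ∉ C, Strategy St (Ac i), C ⊆ G.winners (G.M.run (combine C σC σN))

/-- A strategy profile is in the core iff no coalition has a beneficial
deviation from it. -/
def inCore (G : LTLGame Ag St Ac AP) (σ : Profile St Ac) : Prop :=
  ∀ (C : Set Ag) (σC : ∀ i ∈ C, Strategy St (Ac i)),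
    ¬ G.BeneficialDeviation C σ σC

/-- A (nonempty) coalition `C` is fulfilled if it has a joint strategy
guaranteeing all goals of its members, against every joint strategy of the
remaining players. -/
def Fulfilled (G : LTLGame Ag St Ac AP) (C : Set Ag) : Prop :=
  C.Nonempty ∧
  ∃ σC : ∀ i ∈ C, Strategy St (Ac i),
    ∀ σN : ∀ i ∉ C, Strategy St (Ac i),
      C ⊆ G.winners (G.M.run (combine C σC σN))

/-- `σC` is a strong beneficial deviation for the (nonempty) coalition `C`
from `σ`: (1) all members of `C` lose under `σ`; (2) all members of `C` win
under `(σ₋C, σC)`; (3) against every counter joint strategy `σN` under which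
all original winners still win, all members of `C` win. -/
def StrongBeneficialDeviation (G : LTLGame Ag St Ac AP) (C : Set Ag)
    (σ : Profile St Ac) (σC : ∀ i ∈ C, Strategy St (Ac i)) : Prop :=
  C.Nonempty ∧
  C ⊆ (G.winners (G.M.run σ))ᶜ ∧
  C ⊆ G.winners (G.M.run (combine C σC (fun i _ => σ i))) ∧
  ∀ σN : ∀ i ∉ C, Strategy St (Ac i),
    G.winners (G.M.run σ) ⊆ G.winners (G.M.run (combine C σC σN)) →
      C ⊆ G.winners (G.M.run (combine C σC σN))

/-- A strategy profile is in the strong core iff no coalition has a strong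
beneficial deviation from it. -/
def inStrongCore (G : LTLGame Ag St Ac AP) (σ : Profile St Ac) : Prop :=
  ∀ (C : Set Ag) (σC : ∀ i ∈ C, Strategy St (Ac i)),
    ¬ G.StrongBeneficialDeviation C σ σC

/-- `(G, φ) ∈ E-Core` iff some member of the core of `G` induces a run
satisfying `φ`. -/
def ECore (G : LTLGame Ag St Ac AP) (φ : LTLFormula AP) : Prop :=
  ∃ σ : Profile St Ac, G.inCore σ ∧ φ.Sat G.lab (G.M.run σ)

end LTLGame

namespace EmptyStrongCore

/-- The winners of a one-shot game with two actions per player, as a function of the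
chosen actions. -/
def winningSet : Bool → Bool → Bool → Bool → Finset (Fin 4)
  | false, false, false, false => {0, 1, 2}
  | false, false, false, true => {0, 1, 3}
  | false, false, true, false => {0, 1, 2}
  | false, false, true, true => {2, 3}
  | false, true, false, false => {0, 1}
  | false, true, false, true => {0, 1, 3}
  | false, true, true, false => {0}
  | false, true, true, true => {1, 2}
  | true, false, false, false => {0, 1, 2}
  | true, false, false, true => {3}
  | true, false, true, false => {1}
  | true, false, true, true => {2}
  | true, true, false, false => {0}
  | true, true, false, true => {3}
  | true, true, true, false => {1, 3}
  | true, true, true, true => {0, 2}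

/-- A coalition of losers that can deviate, together with the new actions of its members
(the entries for the other players are irrelevant). -/
def deviation : Bool → Bool → Bool → Bool → Finset (Fin 4) × (Fin 4 → Bool)
  | false, false, false, false => ({3}, ![false, false, false, true])
  | false, false, false, true => ({2}, ![false, false, true, false])
  | false, false, true, false => ({3}, ![false, false, false, true])
  | false, false, true, true => ({1}, ![false, true, false, false])
  | false, true, false, false => ({3}, ![false, false, false, true])
  | false, true, false, true => ({2}, ![false, false, true, false])
  | false, true, true, false => ({1, 2}, ![false, false, true, false])
  | false, true, true, true => ({0}, ![true, false, false, false])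
  | true, false, false, false => ({3}, ![false, false, false, true])
  | true, false, false, true => ({0, 1}, ![false, true, false, false])
  | true, false, true, false => ({0, 2}, ![true, false, false, false])
  | true, false, true, true => ({1, 3}, ![false, true, false, false])
  | true, true, false, false => ({1}, ![false, false, false, false])
  | true, true, false, true => ({0, 1}, ![false, true, false, false])
  | true, true, true, false => ({0}, ![false, false, false, false])
  | true, true, true, true => ({1, 3}, ![false, true, false, false])

/-- The winners when the actions form a vector. -/
def winnersOf (a : Fin 4 → Bool) : Finset (Fin 4) :=
  winningSet (a 0) (a 1) (a 2) (a 3)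

/-- The actions played when `C` follows `d` and everybody else follows `b`. -/
def override (C : Finset (Fin 4)) (d b : Fin 4 → Bool) : Fin 4 → Bool :=
  fun i => if i ∈ C then d i else b i

theorem deviation_spec (a : Fin 4 → Bool) :
    ∃ (C : Finset (Fin 4)) (d : Fin 4 → Bool), C.Nonempty ∧
      Disjoint C (winnersOf a) ∧ C ⊆ winnersOf (override C d a) ∧
      ∀ b : Fin 4 → Bool, winnersOf a ⊆ winnersOf (override C d b) →
        C ⊆ winnersOf (override C d b) := by
  refine ⟨(deviation (a 0) (a 1) (a 2) (a 3)).1, (deviation (a 0) (a 1) (a 2) (a 3)).2, ?_⟩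
  suffices h : ∀ p q r s : Bool, (deviation p q r s).1.Nonempty ∧
      Disjoint (deviation p q r s).1 (winningSet p q r s) ∧
      (deviation p q r s).1 ⊆
        winnersOf (override (deviation p q r s).1 (deviation p q r s).2 ![p, q, r, s]) ∧
      ∀ t u v w : Bool, winningSet p q r s ⊆
          winnersOf (override (deviation p q r s).1 (deviation p q r s).2 ![t, u, v, w]) →
        (deviation p q r s).1 ⊆
          winnersOf (override (deviation p q r s).1 (deviation p q r s).2 ![t, u, v, w]) by
    obtain ⟨h₁, h₂, h₃, h₄⟩ := h (a 0) (a 1) (a 2) (a 3)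
    exact ⟨h₁, h₂, h₃, fun b => h₄ (b 0) (b 1) (b 2) (b 3)⟩
  decide

/-- The LTL game in which all players choose once, and the resulting action vector is
recorded forever. -/
def game : LTLGame (Fin 4) (Option (Fin 4 → Bool)) (fun _ => Bool) (Fin 4) where
  M := { init := none, tr := fun s a => some (s.getD a) }
  lab s := {i | ∃ a ∈ s, i ∈ winnersOf a}
  goal i := .next (.atom i)

/-- The winners depend only on the actions chosen at the initial state. -/
theorem winners_run (σ : Profile (Option (Fin 4 → Bool)) (fun _ : Fin 4 => Bool)) :
    game.winners (game.M.run σ) = winnersOf (fun i => σ i [none]) := by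
  ext i
  simp [LTLGame.winners, LTLFormula.Sat, game, CGS.run, CGS.histRun]

theorem winners_run_combine (C : Finset (Fin 4)) (d : Fin 4 → Bool)
    (σN : ∀ i ∉ (C : Set (Fin 4)), Strategy (Option (Fin 4 → Bool)) Bool) :
    ∃ b : Fin 4 → Bool, (∀ i (h : i ∉ (C : Set (Fin 4))), b i = σN i h [none]) ∧
      game.winners (game.M.run (combine (C : Set (Fin 4)) (fun i _ _ => d i) σN)) =
        winnersOf (override C d b) := by
  classical
  refine ⟨fun i => if h : i ∈ (C : Set (Fin 4)) then d i else σN i h [none],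
    fun i h => dif_neg h, ?_⟩
  rw [winners_run]
  congr 2
  funext i
  by_cases h : i ∈ C <;> simp [combine, override, h]

theorem override_congr {C : Finset (Fin 4)} {d b b' : Fin 4 → Bool}
    (h : ∀ i ∉ C, b i = b' i) : override C d b = override C d b' := by
  funext i
  by_cases hi : i ∈ C <;> simp [override, hi, h]

end EmptyStrongCore

/-- There exists a four-player LTL game `G` whose strong core
`SC(G)` is empty: every strategy profile admits a strong beneficial deviation
by some coalition. -/
theorem exists_four_player_game_with_empty_strongCore :
    ∃ (St AP : Type) (Ac : Fin 4 → Type)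
      (_ : Fintype St) (_ : ∀ i, Fintype (Ac i)) (_ : ∀ i, Nonempty (Ac i))
      (_ : Fintype AP) (G : LTLGame (Fin 4) St Ac AP),
      ∀ σ : Profile St Ac,
        ∃ (C : Set (Fin 4)) (σC : ∀ i ∈ C, Strategy St (Ac i)),
          G.StrongBeneficialDeviation C σ σC := by
  refine ⟨Option (Fin 4 → Bool), Fin 4, fun _ => Bool, inferInstance, fun _ => inferInstance,
    fun _ => inferInstance, inferInstance,
    EmptyStrongCore.game, fun σ => ?_⟩
  obtain ⟨C, d, hne, hdisj, hwin, hcounter⟩ :=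
    EmptyStrongCore.deviation_spec fun i => σ i [none]
  refine ⟨C, fun i _ _ => d i, by simpa using hne, ?_, ?_, fun σN => ?_⟩
  · rw [EmptyStrongCore.winners_run]
    exact Set.subset_compl_iff_disjoint_right.mpr (by exact_mod_cast hdisj)
  · obtain ⟨b, hb, h⟩ := EmptyStrongCore.winners_run_combine C d fun i _ => σ i
    rw [h, EmptyStrongCore.override_congr (b' := fun i => σ i [none]) (by simpa using hb)]
    exact_mod_cast hwin
  · obtain ⟨b, -, h⟩ := EmptyStrongCore.winners_run_combine C d σN
    rw [h, EmptyStrongCore.winners_run]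
    exact_mod_cast hcounter b
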